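/- arXiv:2104.14071 — 2 statements merged into one kernel-verified Lean document; each statement's English description precedes it below -/
import Mathlib

section
/- If a continuous function g: [0,∞) → (0,∞) is in the d-dimensional quadratic max-domain of attraction of the Gumbel distribution with auxiliary function m, i.e., for every d×d nonnegative-definite matrix Q and every x ∈ ℝ^d, g({t·1 + m(t)x} Q {t·1 + m(t)x}ᵀ)/g(t²·1Q1ᵀ) → exp(−x Q 1ᵀ) as t → ∞, where m is continuous and self-neglecting with m(t)/t → 0, then for every nonnegative-definite Q this convergence holds locally uniformly in x ∈ ℝ^d. -/
open Filter Topology Matrix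

lemma rv_meas (φ L : ℝ → ℝ) (hLc : Continuous L) (k : ℝ)
    (hL : ∀ u, Tendsto (fun t => L (t + φ t * u) - L t) atTop (𝓝 (k * u)))
    (x : ℕ → ℝ) (hx : Tendsto x atTop atTop) (M η : ℝ) (hη : 0 < η) :
    Tendsto (fun n => MeasureTheory.volume
      ({v | η ≤ |L (x n + φ (x n) * v) - L (x n) - k * v|} ∩ Set.Icc (-M) M)) atTop (𝓝 0) := by
  have h := MeasureTheory.tendstoInMeasure_of_tendsto_ae
    (μ := MeasureTheory.volume.restrict (Set.Icc (-M) M))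
    (f := fun n v => L (x n + φ (x n) * v) - L (x n) - k * v) (g := fun _ => 0)
    (fun n => (by fun_prop : Continuous _).aestronglyMeasurable)
    (Eventually.of_forall fun v => by
      have := ((hL v).comp hx).sub_const (k * v)
      simpa using this)
  rw [MeasureTheory.tendstoInMeasure_iff_norm] at h
  refine (h η hη).congr fun n => ?_
  rw [MeasureTheory.Measure.restrict_apply]
  · simp
  · exact measurableSet_le measurable_const
      (by fun_prop : Continuous fun v => ‖L (x n + φ (x n) * v) - L (x n) - k * v - 0‖).measurable

lemma rv_A (φ L : ℝ → ℝ) (hφ : ∀ t, 0 < φ t) (hLc : Continuous L) (k : ℝ)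
    (hL : ∀ u, Tendsto (fun t => L (t + φ t * u) - L t) atTop (𝓝 (k * u)))
    (x u : ℕ → ℝ) (hx : Tendsto x atTop atTop)
    (hy : Tendsto (fun n => x n + φ (x n) * u n) atTop atTop)
    (R a b : ℝ) (ha : 0 < a) (hu : ∀ᶠ n in atTop, |u n| ≤ R)
    (hc : ∀ᶠ n in atTop, a ≤ φ (x n + φ (x n) * u n) / φ (x n) ∧
      φ (x n + φ (x n) * u n) / φ (x n) ≤ b)
    (hk : Tendsto (fun n => k * (φ (x n + φ (x n) * u n) / φ (x n) - 1)) atTop (𝓝 0)) :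
    Tendsto (fun n => L (x n + φ (x n) * u n) - L (x n) - k * u n) atTop (𝓝 0) := by
  rw [Metric.tendsto_atTop'] 
  suffices H : ∀ ε > 0, ∀ᶠ n in atTop, |L (x n + φ (x n) * u n) - L (x n) - k * u n| < ε by
    intro ε hε
    obtain ⟨N, hN⟩ := eventually_atTop.1 (H ε hε)
    exact ⟨N, fun n hn => by simpa [Real.dist_eq] using hN n hn.le⟩
  intro ε hε
  have hη : 0 < ε / 4 := by positivity
  have h1 := rv_meas φ L hLc k hL x hx (R + b) (ε / 4) hη
  have h2 := rv_meas φ L hLc k hL _ hy 1 (ε / 4) hη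
  have e1 := h1.eventually (gt_mem_nhds (show (0:ENNReal) < ENNReal.ofReal (a / 2) by
    simpa using ha))
  have e2 := h2.eventually (gt_mem_nhds (show (0:ENNReal) < ENNReal.ofReal (1 / 2) by simp))
  have e3 := hk.eventually (Metric.ball_mem_nhds 0 hη)
  filter_upwards [e1, e2, e3, hu, hc] with n e1 e2 e3 hu hc
  set y := x n + φ (x n) * u n with hyd
  set c := φ y / φ (x n) with hcd
  have hc0 : 0 < c := ha.trans_le hc.1
  have hφx := hφ (x n)
  have hφy : φ y = c * φ (x n) := by rw [hcd]; field_simp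
  set B1 := {v | ε / 4 ≤ |L (x n + φ (x n) * v) - L (x n) - k * v|} ∩ Set.Icc (-(R + b)) (R + b)
  set B2 := {v | ε / 4 ≤ |L (y + φ y * v) - L y - k * v|} ∩ Set.Icc (-1) 1
  have hpre : MeasureTheory.volume ((fun w => c * w) ⁻¹' ((fun w => u n + w) ⁻¹' B1))
      < ENNReal.ofReal (1 / 2) := by
    rw [Real.volume_preimage_mul_left hc0.ne', MeasureTheory.measure_preimage_add,
      abs_of_pos (inv_pos.2 hc0)]
    calc _ < ENNReal.ofReal c⁻¹ * ENNReal.ofReal (a / 2) := by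
            refine ENNReal.mul_lt_mul_right ?_ ?_ e1
            · simpa using hc0
            · simp
      _ = ENNReal.ofReal (c⁻¹ * (a / 2)) := by rw [ENNReal.ofReal_mul (by positivity)]
      _ ≤ _ := by
        apply ENNReal.ofReal_le_ofReal
        rw [inv_mul_le_iff₀ hc0]; linarith [hc.1]
  obtain ⟨w, hw, hwB⟩ : ∃ w ∈ Set.Icc (0:ℝ) 1,
      w ∉ B2 ∪ (fun w => c * w) ⁻¹' ((fun w => u n + w) ⁻¹' B1) := by
    by_contra! hcon
    have h3 : MeasureTheory.volume (Set.Icc (0:ℝ) 1) ≤ _ := MeasureTheory.measure_mono hcon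
    have h4 := h3.trans (MeasureTheory.measure_union_le _ _)
    have h5 := h4.trans_lt (ENNReal.add_lt_add e2 hpre)
    rw [← ENNReal.ofReal_add (by norm_num) (by norm_num)] at h5
    norm_num at h5
  have hb1 : |L (x n + φ (x n) * (u n + c * w)) - L (x n) - k * (u n + c * w)| < ε / 4 := by
    by_contra! h
    refine hwB (Or.inr ⟨h, ?_⟩)
    have := abs_le.1 hu
    have h6 : c * w ≤ b := by nlinarith [hw.1, hw.2, hc.2]
    have h7 : 0 ≤ c * w := mul_nonneg hc0.le hw.1
    constructor <;> simp only <;> linarith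
  have hb2 : |L (y + φ y * w) - L y - k * w| < ε / 4 := by
    by_contra! h
    exact hwB (Or.inl ⟨h, by linarith [hw.1], hw.2⟩)
  have hp : x n + φ (x n) * (u n + c * w) = y + φ y * w := by rw [hφy, hyd]; ring
  rw [hp] at hb1
  have hb3 : |k * (c - 1)| < ε / 4 := by simpa [Real.dist_eq] using e3
  have hb4 : |k * (c - 1) * w| < ε / 4 := by
    rw [abs_mul, abs_of_nonneg hw.1]
    nlinarith [abs_nonneg (k * (c - 1)), hw.2]
  rw [abs_lt] at *
  constructor <;> nlinarith

lemma rv_y (m : ℝ → ℝ) (hm_pos : ∀ t, 0 < m t)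
    (hm_small : Tendsto (fun t => m t / t) atTop (𝓝 0))
    (x u : ℕ → ℝ) (hx : Tendsto x atTop atTop) (R : ℝ) (hu : ∀ᶠ n in atTop, |u n| ≤ R) :
    Tendsto (fun n => x n + m (x n) * u n) atTop atTop := by
  have h1 := (hm_small.comp hx).mul_const R
  rw [zero_mul] at h1
  have e1 := h1.eventually (gt_mem_nhds (show (0:ℝ) < 1 / 2 by norm_num))
  refine tendsto_atTop_mono' _ ?_ (hx.atTop_mul_const (show (0:ℝ) < 1 / 2 by norm_num))
  filter_upwards [e1, hu, hx.eventually_gt_atTop 0] with n e1 hu h0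
  simp only [Function.comp] at e1
  rw [div_mul_eq_mul_div, div_lt_iff₀ h0] at e1
  have := mul_le_mul_of_nonneg_left (neg_le_of_abs_le hu) (hm_pos (x n)).le
  linarith

lemma rv_bloom (m : ℝ → ℝ) (hm_cont : Continuous m) (hm_pos : ∀ t, 0 < m t)
    (hm_sn : ∀ x : ℝ, Tendsto (fun t => m (t + m t * x) / m t) atTop (𝓝 1))
    (hm_small : Tendsto (fun t => m t / t) atTop (𝓝 0))
    (x u : ℕ → ℝ) (hx : Tendsto x atTop atTop) (R : ℝ) (hu : ∀ᶠ n in atTop, |u n| ≤ R) :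
    Tendsto (fun n => m (x n + m (x n) * u n) / m (x n)) atTop (𝓝 1) := by
  rw [Metric.tendsto_nhds]
  suffices H : ∀ ε > 0, ε < 1 →
      ∀ᶠ n in atTop, |m (x n + m (x n) * u n) / m (x n) - 1| < ε by
    intro ε hε
    filter_upwards [H (min ε (1 / 2)) (by positivity) (by norm_num)] with n hn
    exact hn.trans_le (min_le_left _ _)
  intro ε hε hε1
  have key : ∀ n, ∃ v, |v| ≤ |u n| ∧ |m (x n + m (x n) * v) / m (x n) - 1| ≤ ε ∧
      (|m (x n + m (x n) * v) / m (x n) - 1| < ε →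
        |m (x n + m (x n) * u n) / m (x n) - 1| < ε) := by
    intro n
    by_cases h : |m (x n + m (x n) * u n) / m (x n) - 1| < ε
    · exact ⟨u n, le_rfl, h.le, fun _ => h⟩
    · push Not at h
      have hcont : Continuous fun v => |m (x n + m (x n) * v) / m (x n) - 1| := by fun_prop
      have := intermediate_value_uIcc (a := 0) (b := u n) hcont.continuousOn
      obtain ⟨v, hv, hve⟩ := this (show ε ∈ _ by
        have h0 := (hm_pos (x n)).ne'
        rw [Set.mem_uIcc]
        left
        refine ⟨?_, h⟩
        simp [h0, hε.le])
      simp only at hve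
      refine ⟨v, ?_, hve.le, fun h => absurd hve h.ne⟩
      rw [Set.mem_uIcc] at hv
      rcases hv with hv | hv
      · exact abs_le_abs_of_nonneg hv.1 hv.2
      · exact abs_le_abs_of_nonpos hv.2 hv.1
  choose v hv1 hv2 hv3 using key
  have hvR : ∀ᶠ n in atTop, |v n| ≤ R := hu.mono fun n h => (hv1 n).trans h
  have hlog := rv_A m (fun t => Real.log (m t)) hm_pos
    (hm_cont.log fun t => (hm_pos t).ne') 0 (fun w => by
      have := (Real.continuousAt_log one_ne_zero).tendsto.comp (hm_sn w)
      simp only [Real.log_one, zero_mul] at this ⊢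
      refine this.congr fun t => ?_
      simp only [Function.comp]
      rw [Real.log_div (hm_pos _).ne' (hm_pos _).ne'])
    x v hx (rv_y m hm_pos hm_small x v hx R hvR) R (1 - ε) (1 + ε) (by linarith) hvR
    (Eventually.of_forall fun n => by
      have := abs_le.1 (hv2 n)
      constructor <;> linarith) (by simp)
  have h2 := (Real.continuous_exp.tendsto 0).comp hlog
  have h3 : Tendsto (fun n => m (x n + m (x n) * v n) / m (x n)) atTop (𝓝 1) := by
    rw [Real.exp_zero] at h2
    refine h2.congr fun n => ?_
    simp [Real.exp_sub, Real.exp_log (hm_pos _)]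
  filter_upwards [Metric.tendsto_nhds.1 h3 ε hε] with n hn
  exact hv3 n hn

lemma rv_unif (m h : ℝ → ℝ) (hm_cont : Continuous m) (hm_pos : ∀ t, 0 < m t)
    (hm_sn : ∀ x : ℝ, Tendsto (fun t => m (t + m t * x) / m t) atTop (𝓝 1))
    (hm_small : Tendsto (fun t => m t / t) atTop (𝓝 0))
    (hh_cont : Continuous h) (hh_pos : ∀ t, 0 < h t) (k : ℝ)
    (hh : ∀ u, Tendsto (fun t => h (t + m t * u) / h t) atTop (𝓝 (Real.exp (k * u))))
    (x u : ℕ → ℝ) (hx : Tendsto x atTop atTop) (R : ℝ) (hu : ∀ᶠ n in atTop, |u n| ≤ R) :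
    Tendsto (fun n => Real.log (h (x n + m (x n) * u n)) - Real.log (h (x n)) - k * u n)
      atTop (𝓝 0) := by
  have hb := rv_bloom m hm_cont hm_pos hm_sn hm_small x u hx R hu
  refine rv_A m (fun t => Real.log (h t)) hm_pos
    (hh_cont.log fun t => (hh_pos t).ne') k (fun w => ?_)
    x u hx (rv_y m hm_pos hm_small x u hx R hu) R (1 / 2) 2 (by norm_num) hu ?_ ?_
  · have := (Real.continuousAt_log (Real.exp_pos _).ne').tendsto.comp (hh w)
    rw [Real.log_exp] at this
    refine this.congr fun t => ?_
    simp only [Function.comp]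
    rw [Real.log_div (hh_pos _).ne' (hh_pos _).ne']
  · filter_upwards [hb.eventually (lt_mem_nhds (show (1 / 2 : ℝ) < 1 by norm_num)),
      hb.eventually (gt_mem_nhds (show (1 : ℝ) < 2 by norm_num))] with n h1 h2
    exact ⟨h1.le, h2.le⟩
  · simpa using (hb.sub_const 1).const_mul k

lemma rv_zero (m h : ℝ → ℝ) (hm_cont : Continuous m) (hm_pos : ∀ t, 0 < m t)
    (hh_cont : Continuous h) (hh_pos : ∀ t, 0 < h t) 
    (hh : ∀ᶠ t in atTop, h (t + m t) / h t ≤ 1 / 2) : Tendsto h atTop (𝓝 0) := by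
  obtain ⟨T, hT⟩ := eventually_atTop.1 hh
  have ivt : ∀ T' ≥ T, ∀ s ≥ T' + m T', ∃ t, T' ≤ t ∧ t < s ∧ h s ≤ h t / 2 := by
    intro T' hT' s hs
    have hcont : Continuous fun t => t + m t := by fun_prop
    have hle : T' ≤ s := by linarith [hm_pos T']
    obtain ⟨t, ht, hts⟩ := intermediate_value_Icc hle hcont.continuousOn
      (show s ∈ _ from ⟨hs, by linarith [hm_pos s]⟩)
    simp only at hts
    refine ⟨t, ht.1, by linarith [hm_pos t], ?_⟩
    have := hT t (hT'.trans ht.1)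
    rw [hts, div_le_iff₀ (hh_pos t)] at this
    linarith
  obtain ⟨p, hp, hpm⟩ := (isCompact_Icc (a := T) (b := T + m T)).exists_isMaxOn
    (Set.nonempty_Icc.2 (by linarith [hm_pos T])) hh_cont.continuousOn
  have hbound : ∀ s ≥ T, h s ≤ h p := by
    intro s hs
    obtain ⟨r, hr, hrm⟩ := (isCompact_Icc (a := T) (b := s)).exists_isMaxOn
      (Set.nonempty_Icc.2 hs) hh_cont.continuousOn
    have h1 : h s ≤ h r := hrm ⟨hs, le_rfl⟩
    refine h1.trans ?_
    by_cases hc : r ≤ T + m T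
    · exact hpm ⟨hr.1, hc⟩
    · push Not at hc
      obtain ⟨t, ht1, ht2, ht3⟩ := ivt T le_rfl r hc.le
      have h2 : h t ≤ h r := hrm ⟨ht1, ht2.le.trans hr.2⟩
      linarith [hh_pos r]
  have iter : ∀ n : ℕ, ∃ T' ≥ T, ∀ s ≥ T', h s ≤ h p * (1 / 2) ^ n := by
    intro n
    induction n with
    | zero => exact ⟨T, le_rfl, by simpa using hbound⟩
    | succ n ih =>
      obtain ⟨T', hT', hs⟩ := ih
      refine ⟨T' + m T', by linarith [hm_pos T'], fun s hs' => ?_⟩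
      obtain ⟨t, ht1, _, ht3⟩ := ivt T' hT' s hs'
      have := hs t ht1
      rw [pow_succ]
      linarith
  rw [Metric.tendsto_nhds]
  intro ε hε
  have hl : Tendsto (fun n : ℕ => h p * (1 / 2 : ℝ) ^ n) atTop (𝓝 0) := by
    simpa using (tendsto_pow_atTop_nhds_zero_of_lt_one (by norm_num) (by norm_num :
      (1 / 2 : ℝ) < 1)).const_mul (h p)
  obtain ⟨n, hn⟩ := (hl.eventually (gt_mem_nhds hε)).exists
  obtain ⟨T', _, hs⟩ := iter n
  filter_upwards [eventually_ge_atTop T'] with s hs'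
  rw [Real.dist_eq, sub_zero, abs_of_pos (hh_pos s)]
  exact (hs s hs').trans_lt hn

lemma rv_expand (d : ℕ) (Q : Matrix (Fin d) (Fin d) ℝ) (hQ : Q.PosSemidef) (x : Fin d → ℝ)
    (t c : ℝ) :
    (fun i => t + c * x i) ⬝ᵥ Q.mulVec (fun i => t + c * x i) =
      t ^ 2 * ((fun _ => (1:ℝ)) ⬝ᵥ Q.mulVec (fun _ => (1:ℝ)))
        + 2 * t * c * (x ⬝ᵥ Q.mulVec (fun _ => (1:ℝ))) + c ^ 2 * (x ⬝ᵥ Q.mulVec x) := by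
  have hsym : (fun _ => (1:ℝ)) ⬝ᵥ Q.mulVec x = x ⬝ᵥ Q.mulVec (fun _ => (1:ℝ)) := by
    have : Qᵀ = Q := by simpa using hQ.isHermitian.eq
    rw [dotProduct_mulVec, ← mulVec_transpose, this, dotProduct_comm]
  have he : (fun i => t + c * x i) = t • (fun _ => (1:ℝ)) + c • x := by
    ext i; simp
  rw [he, mulVec_add, mulVec_smul, mulVec_smul]
  simp only [add_dotProduct, dotProduct_add, smul_dotProduct, dotProduct_smul, smul_eq_mul, hsym]
  ring

lemma rv_red (d : ℕ) (g m : ℝ → ℝ) (Q : Matrix (Fin d) (Fin d) ℝ) (hQ : Q.PosSemidef)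
    (h : ∀ x : Fin d → ℝ,
      Tendsto (fun t =>
          g ((fun i => t + m t * x i) ⬝ᵥ Q.mulVec (fun i => t + m t * x i)) /
            g (t ^ 2 * ((fun _ => (1:ℝ)) ⬝ᵥ Q.mulVec (fun _ => (1:ℝ)))))
        atTop (𝓝 (Real.exp (-(x ⬝ᵥ Q.mulVec (fun _ => (1:ℝ))))))) (q : ℝ)
    (hq : q = (fun _ => (1:ℝ)) ⬝ᵥ Q.mulVec (fun _ => (1:ℝ))) (u : ℝ) :
    Tendsto (fun t => g (q * (t + m t * u) ^ 2) / g (q * t ^ 2)) atTop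
      (𝓝 (Real.exp (-q * u))) := by
  have h1 := h (fun _ => u)
  have he : (fun _ : Fin d => u) = u • (fun _ => (1:ℝ)) := by ext; simp
  simp only [rv_expand d Q hQ] at h1
  rw [he, mulVec_smul] at h1
  simp only [smul_dotProduct, dotProduct_smul, smul_eq_mul, ← hq] at h1
  have e : -(u * q) = -q * u := by ring
  rw [e] at h1
  refine h1.congr fun t => ?_
  congr 2 <;> ring

theorem rapid_variation_stmt12 (d : ℕ) (g m : ℝ → ℝ)
    (hg_cont : Continuous g) (hg_pos : ∀ t, 0 < g t)
    (hm_cont : Continuous m) (hm_pos : ∀ t, 0 < m t)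
    (hm_sn : ∀ x : ℝ, Tendsto (fun t => m (t + m t * x) / m t) atTop (𝓝 1))
    (hm_small : Tendsto (fun t => m t / t) atTop (𝓝 0))
    (hMDA : ∀ Q : Matrix (Fin d) (Fin d) ℝ, Q.PosSemidef → ∀ x : Fin d → ℝ,
      Tendsto (fun t =>
          g ((fun i => t + m t * x i) ⬝ᵥ Q.mulVec (fun i => t + m t * x i)) /
            g (t ^ 2 * ((fun _ => (1:ℝ)) ⬝ᵥ Q.mulVec (fun _ => (1:ℝ)))))
        atTop (𝓝 (Real.exp (-(x ⬝ᵥ Q.mulVec (fun _ => (1:ℝ))))))) :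
    ∀ Q : Matrix (Fin d) (Fin d) ℝ, Q.PosSemidef →
      ∀ K : Set (Fin d → ℝ), IsCompact K →
        TendstoUniformlyOn (fun t x =>
            g ((fun i => t + m t * x i) ⬝ᵥ Q.mulVec (fun i => t + m t * x i)) /
              g (t ^ 2 * ((fun _ => (1:ℝ)) ⬝ᵥ Q.mulVec (fun _ => (1:ℝ)))))
          (fun x => Real.exp (-(x ⬝ᵥ Q.mulVec (fun _ => (1:ℝ))))) atTop K := by
  intro Q hQ K hK
  have hred := rv_red d g m Q hQ (hMDA Q hQ) _ rfl
  have hq0 : 0 ≤ (fun _ => (1:ℝ)) ⬝ᵥ Q.mulVec (fun _ => (1:ℝ)) := by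
    have := hQ.dotProduct_mulVec_nonneg (fun _ => (1:ℝ))
    have e : star (fun _ : Fin d => (1:ℝ)) = fun _ => 1 := by ext; simp
    rwa [e] at this
  have hP0 : ∀ x : Fin d → ℝ, 0 ≤ x ⬝ᵥ Q.mulVec x := fun x => by
    have := hQ.dotProduct_mulVec_nonneg x
    rwa [star_trivial] at this
  have hBc : Continuous fun x : Fin d → ℝ => x ⬝ᵥ Q.mulVec (fun _ => (1:ℝ)) := by fun_prop
  have hrc : Continuous fun x : Fin d → ℝ => x ⬝ᵥ Q.mulVec x := by fun_prop
  obtain ⟨CB, hCB⟩ := hK.exists_bound_of_continuousOn hBc.continuousOn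
  obtain ⟨Cr, hCr⟩ := hK.exists_bound_of_continuousOn hrc.continuousOn
  rw [tendstoUniformlyOn_iff_tendsto, tendsto_iff_seq_tendsto]
  intro s hs
  have ht : Tendsto (fun n => (s n).1) atTop atTop := tendsto_fst.comp hs
  have hx : ∀ᶠ n in atTop, (s n).2 ∈ K := by
    have := (tendsto_snd.comp hs)
    exact tendsto_principal.1 this
  rw [tendsto_uniformity_iff_dist_tendsto_zero]
  simp only [Function.comp_def]
  generalize htd : (fun n => (s n).1) = t at ht
  generalize hxd : (fun n => (s n).2) = x at hx
  have ht1 : ∀ n, (s n).1 = t n := fun n => congrFun htd n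
  have hx1 : ∀ n, (s n).2 = x n := fun n => congrFun hxd n
  simp only [ht1, hx1] at hx ⊢
  rcases hq0.eq_or_lt with hq | hq
  · -- degenerate case
    have hQ1 : Q.mulVec (fun _ => (1:ℝ)) = 0 := by
      rw [← hQ.dotProduct_mulVec_zero_iff, star_trivial]; exact hq.symm
    simp only [rv_expand d Q hQ, hQ1, dotProduct_zero, mul_zero, zero_add, neg_zero,
      Real.exp_zero, add_zero]
    by_cases hr : ∀ x : Fin d → ℝ, x ⬝ᵥ Q.mulVec x = 0
    · simp [hr, (hg_pos 0).ne']
    push Not at hr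
    obtain ⟨x0, hx0⟩ := hr
    have hr0 : 0 < x0 ⬝ᵥ Q.mulVec x0 := lt_of_le_of_ne (hP0 x0) hx0.symm
    have hd : 0 < d := by
      rcases Nat.eq_zero_or_pos d with h | h
      · subst h; simp [dotProduct] at hx0
      · exact h
    have hd' : (1:ℝ) ≤ d := by exact_mod_cast hd
    -- g tends to zero at infinity
    have hone := rv_red d g m 1 Matrix.PosSemidef.one (hMDA 1 Matrix.PosSemidef.one) d
      (by simp [dotProduct]) 1
    have hh0 := rv_zero m (fun t => g (d * t ^ 2)) hm_cont hm_pos (by fun_prop)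
      (fun t => hg_pos _) (by
        have hlt : Real.exp (-(d:ℝ) * 1) < 1 / 2 := by
          have h1 : Real.exp (-(d:ℝ) * 1) ≤ Real.exp (-1) := Real.exp_le_exp.2 (by linarith)
          have h2 := Real.exp_neg_one_lt_d9
          norm_num at h2
          linarith
        filter_upwards [hone.eventually (gt_mem_nhds hlt)] with t ht
        simpa using ht.le)
    have hg0 := hg_pos 0
    obtain ⟨S, hS⟩ := eventually_atTop.1 (hh0.eventually (gt_mem_nhds (half_pos hg0)))
    have hlim : ∀ c : ℝ, Tendsto (fun t => g (m t ^ 2 * (c ^ 2 * (x0 ⬝ᵥ Q.mulVec x0))) / g 0)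
        atTop (𝓝 1) := by
      intro c
      have := hMDA Q hQ (c • x0)
      simp only [rv_expand d Q hQ, hQ1, dotProduct_zero, mul_zero, zero_add, neg_zero,
        Real.exp_zero, add_zero] at this
      refine this.congr fun t => ?_
      rw [mulVec_smul, smul_dotProduct, dotProduct_smul]
      simp only [smul_eq_mul]
      ring_nf
    have hm0 : Tendsto m atTop (𝓝 0) := by
      rw [Metric.tendsto_nhds]
      intro ε hε
      set r0 := x0 ⬝ᵥ Q.mulVec x0
      set c := Real.sqrt (d * (|S|) ^ 2 / r0) / ε with hc
      have hc2 : c ^ 2 * r0 * ε ^ 2 = d * |S| ^ 2 := by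
        rw [hc, div_pow, Real.sq_sqrt (by positivity)]
        field_simp
      filter_upwards [(hlim c).eventually (lt_mem_nhds (show (1/2:ℝ) < 1 by norm_num))] with t h1
      rw [Real.dist_eq, sub_zero, abs_of_pos (hm_pos t)]
      by_contra! h2
      have h3 : (d:ℝ) * |S| ^ 2 ≤ m t ^ 2 * (c ^ 2 * r0) := by
        rw [← hc2, mul_comm]
        gcongr
      have h4 : |S| ^ 2 ≤ m t ^ 2 * (c ^ 2 * r0) / d := by
        rw [le_div_iff₀ (by linarith)]; linarith
      have h5 := hS (Real.sqrt (m t ^ 2 * (c ^ 2 * r0) / d))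
        ((le_abs_self S).trans (Real.le_sqrt_of_sq_le h4))
      rw [Real.sq_sqrt (by positivity), mul_div_cancel₀ _ (by positivity)] at h5
      rw [lt_div_iff₀ hg0] at h1
      linarith
    have h6 : Tendsto (fun n => m (t n) ^ 2 * (x n ⬝ᵥ Q.mulVec (x n))) atTop (𝓝 0) := by
      have h7 : Tendsto (fun n => m (t n) ^ 2 * Cr) atTop (𝓝 0) := by
        simpa using ((hm0.comp ht).pow 2).mul_const Cr
      refine squeeze_zero' (Eventually.of_forall fun n => mul_nonneg (sq_nonneg _) (hP0 _)) ?_ h7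
      filter_upwards [hx] with n hn
      exact mul_le_mul_of_nonneg_left ((le_abs_self _).trans (hCr _ hn)) (sq_nonneg _)
    have h8 := (((hg_cont.tendsto 0).comp h6).div_const (g 0))
    rw [div_self hg0.ne'] at h8
    simpa [Function.comp_def] using (tendsto_const_nhds (x := (1:ℝ))).dist h8
  · -- nondegenerate case
    have hPn : ∀ n, 0 ≤ (t n) ^ 2 * ((fun _ => (1:ℝ)) ⬝ᵥ Q.mulVec (fun _ => (1:ℝ)))
        + 2 * t n * m (t n) * (x n ⬝ᵥ Q.mulVec (fun _ => (1:ℝ)))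
        + m (t n) ^ 2 * (x n ⬝ᵥ Q.mulVec (x n)) := fun n => by
      rw [← rv_expand d Q hQ]; exact hP0 _
    simp only [rv_expand d Q hQ]
    generalize (fun _ => (1:ℝ)) ⬝ᵥ Q.mulVec (fun _ => (1:ℝ)) = q at *
    have hbB : ∀ᶠ n in atTop, |x n ⬝ᵥ Q.mulVec (fun _ => (1:ℝ))| ≤ CB := by
      filter_upwards [hx] with n hn using hCB _ hn
    have hrB : ∀ᶠ n in atTop, |x n ⬝ᵥ Q.mulVec (x n)| ≤ Cr := by
      filter_upwards [hx] with n hn using hCr _ hn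
    obtain ⟨b, hb⟩ : ∃ b : ℕ → ℝ, ∀ n, x n ⬝ᵥ Q.mulVec (fun _ => (1:ℝ)) = b n := ⟨_, fun _ => rfl⟩
    obtain ⟨r, hr⟩ : ∃ r : ℕ → ℝ, ∀ n, x n ⬝ᵥ Q.mulVec (x n) = r n := ⟨_, fun _ => rfl⟩
    simp only [hb, hr] at *
    set P : ℕ → ℝ := fun n => t n ^ 2 * q + 2 * t n * m (t n) * b n + m (t n) ^ 2 * r n with hP
    set y : ℕ → ℝ := fun n => (Real.sqrt (P n / q) - t n) / m (t n) with hy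
    have hyP : ∀ n, q * (t n + m (t n) * y n) ^ 2 = P n := by
      intro n
      have h0 := (hm_pos (t n)).ne'
      have : t n + m (t n) * y n = Real.sqrt (P n / q) := by
        rw [hy]; field_simp; ring
      rw [this, Real.sq_sqrt (div_nonneg (hPn n) hq.le), mul_div_cancel₀ _ hq.ne']
    have hδ : Tendsto (fun n => m (t n) / t n) atTop (𝓝 0) := hm_small.comp ht
    have hbdd : ∀ (w : ℕ → ℝ) (C : ℝ), (∀ᶠ n in atTop, |w n| ≤ C) → ∀ v : ℕ → ℝ,
        Tendsto v atTop (𝓝 0) → Tendsto (fun n => v n * w n) atTop (𝓝 0) := by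
      intro w C hw v hv
      refine hv.zero_mul_isBoundedUnder_le ⟨C, ?_⟩
      simpa [eventually_map] using hw
    have h1 : Tendsto (fun n => m (t n) / t n * b n) atTop (𝓝 0) := hbdd b CB hbB _ hδ
    have h2 : Tendsto (fun n => m (t n) / t n * r n) atTop (𝓝 0) := hbdd r Cr hrB _ hδ
    -- ratio
    have h3 : Tendsto (fun n => Real.sqrt (1 + 2 / q * (m (t n) / t n * b n)
        + 1 / q * (m (t n) / t n * (m (t n) / t n * r n)))) atTop (𝓝 1) := by
      have := (Real.continuous_sqrt.tendsto 1).comp (show Tendsto (fun n =>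
        (1 + 2 / q * (m (t n) / t n * b n)
        + 1 / q * (m (t n) / t n * (m (t n) / t n * r n)))) atTop (𝓝 1) by
          simpa using ((h1.const_mul (2 / q)).const_add 1).add ((hδ.mul h2).const_mul (1 / q)))
      simpa [Function.comp_def] using this
    set ρ : ℕ → ℝ := fun n => Real.sqrt (1 + 2 / q * (m (t n) / t n * b n)
        + 1 / q * (m (t n) / t n * (m (t n) / t n * r n))) with hρ
    have hyeq : ∀ᶠ n in atTop, y n - b n / q =
        ((2 / (ρ n + 1) - 1) * b n + 1 / (ρ n + 1) * (m (t n) / t n * r n)) / q := by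
      filter_upwards [ht.eventually_gt_atTop 0] with n hn
      have hm0 := hm_pos (t n)
      have hρn : 0 ≤ ρ n := Real.sqrt_nonneg _
      have hPe : P n / q = t n ^ 2 * (1 + 2 / q * (m (t n) / t n * b n)
        + 1 / q * (m (t n) / t n * (m (t n) / t n * r n))) := by
        simp only [hP]; field_simp
      have hin : 0 ≤ 1 + 2 / q * (m (t n) / t n * b n)
        + 1 / q * (m (t n) / t n * (m (t n) / t n * r n)) := by
        have h := div_nonneg (hPn n) hq.le
        rw [hPe] at h
        exact nonneg_of_mul_nonneg_right h (by positivity)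
      have hs : Real.sqrt (P n / q) = t n * ρ n := by
        rw [hPe, Real.sqrt_mul (by positivity), Real.sqrt_sq hn.le]
      have hρ2 : ρ n ^ 2 = 1 + 2 / q * (m (t n) / t n * b n)
        + 1 / q * (m (t n) / t n * (m (t n) / t n * r n)) := Real.sq_sqrt hin
      have hy' : y n = t n * (ρ n - 1) / m (t n) := by
        simp only [hy]; rw [hs]; ring
      have hρ3 : ρ n - 1 = (ρ n ^ 2 - 1) / (ρ n + 1) := by field_simp; ring
      rw [hy', hρ3, hρ2]
      have : ρ n + 1 ≠ 0 := by positivity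
      field_simp
      ring
    have h4 : Tendsto (fun n => 1 / (ρ n + 1)) atTop (𝓝 (1 / 2)) := by
      have := (h3.add_const 1).inv₀ (by norm_num)
      norm_num at this
      simpa using this
    have hyb : Tendsto (fun n => y n - b n / q) atTop (𝓝 0) := by
      rw [tendsto_congr' hyeq]
      have h5 : Tendsto (fun n => 2 / (ρ n + 1) - 1) atTop (𝓝 0) := by
        have := (h4.const_mul 2).sub_const 1
        norm_num at this
        refine this.congr fun n => by ring
      simpa using ((hbdd b CB hbB _ h5).add (h4.mul h2)).div_const q
    have hyR : ∀ᶠ n in atTop, |y n| ≤ CB / q + 1 := by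
      filter_upwards [hbB, Metric.tendsto_nhds.1 hyb 1 one_pos] with n h5 h6
      rw [Real.dist_eq, sub_zero] at h6
      have h7 : |b n / q| ≤ CB / q := by
        rw [abs_div, abs_of_pos hq]; gcongr
      have := abs_add_le (y n - b n / q) (b n / q)
      rw [sub_add_cancel] at this
      linarith
    have hU := rv_unif m (fun t => g (q * t ^ 2)) hm_cont hm_pos hm_sn hm_small (by fun_prop)
      (fun t => hg_pos _) (-q) hred t y ht _ hyR
    simp only [hyP] at hU
    have hW : Tendsto (fun n => Real.log (g (P n)) - Real.log (g (q * t n ^ 2)) + b n)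
        atTop (𝓝 0) := by
      have := hU.sub (hyb.const_mul q)
      simp only [mul_zero, sub_zero] at this
      refine this.congr fun n => ?_
      field_simp
      ring
    have hE : Tendsto (fun n => Real.exp (Real.log (g (P n)) - Real.log (g (q * t n ^ 2)) + b n) - 1)
        atTop (𝓝 0) := by
      have := ((Real.continuous_exp.tendsto 0).comp hW).sub_const 1
      simpa [Function.comp_def] using this
    have hF := hbdd (fun n => Real.exp (-b n)) (Real.exp CB) (by
      filter_upwards [hbB] with n hn
      rw [abs_of_pos (Real.exp_pos _)]
      exact Real.exp_le_exp.2 (by linarith [neg_le_of_abs_le hn])) _ hE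
    have hG := hF.abs
    rw [abs_zero] at hG
    refine hG.congr fun n => ?_
    rw [dist_comm, Real.dist_eq, sub_mul, one_mul, ← Real.exp_add, add_neg_cancel_right,
      Real.exp_sub, Real.exp_log (hg_pos _), Real.exp_log (hg_pos _), mul_comm q]
end

section
/- Let g_{d+1}: [0,∞) → (0,∞) be a continuous density generator in the quadratic max-domain of attraction of the Gumbel distribution with auxiliary function m (continuous, self-neglecting, m(t)/t → 0). Define g_d(s) = 2∫_0^∞ g_{d+1}(r² + s) dr. Then for every positive-definite Σ ∈ ℝ^{d×d}, g_d({t·1 + m(t)w} Σ⁻¹ {t·1 + m(t)w}ᵀ)/g_d(t² · 1Σ⁻¹1ᵀ) → exp(−w Σ⁻¹ 1ᵀ) as t → ∞, locally uniformly in w ∈ ℝ^d. -/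
open Filter Topology Matrix MeasureTheory

lemma uct_core (F m : ℝ → ℝ) (hF : Continuous F) (hm_pos : ∀ t, 0 < m t) (q : ℝ)
    (hp : ∀ v, Tendsto (fun t => F (t + m t * v) - F t + q * v) atTop (𝓝 0))
    (t s u : ℕ → ℝ) (ht : Tendsto t atTop atTop) (hs : Tendsto s atTop atTop)
    (hsu : ∀ n, s n = t n + m (t n) * u n) (A : ℝ) (hu : ∀ n, |u n| ≤ A)
    (hl : ∀ᶠ n in atTop, 1 / 2 ≤ m (s n) / m (t n) ∧ m (s n) / m (t n) ≤ 2)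
    (ε : ℝ) (hε : 0 < ε) :
    ∀ᶠ n in atTop, |F (s n) - F (t n) + q * u n| ≤ ε + |q| * |m (s n) / m (t n) - 1| := by
  set B := A + 2 with hB
  have key : ∀ (r : ℕ → ℝ), Tendsto r atTop atTop → ∀ B : ℝ,
      ∀ᶠ n in atTop, volume ({v : ℝ | ε / 2 ≤ |F (r n + m (r n) * v) - F (r n) + q * v|} ∩
        Set.Icc (-B) B) < ENNReal.ofReal (1 / 4) := by
    intro r hr B
    have h1 : TendstoInMeasure (volume.restrict (Set.Icc (-B) B))
        (fun n v => F (r n + m (r n) * v) - F (r n) + q * v) atTop (fun _ => (0:ℝ)) := by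
      apply tendstoInMeasure_of_tendsto_ae
      · intro n
        apply Continuous.aestronglyMeasurable
        fun_prop
      · exact Filter.Eventually.of_forall (fun v => (hp v).comp hr)
    rw [tendstoInMeasure_iff_norm] at h1
    have h2 := (h1 (ε / 2) (by positivity)).eventually
      (gt_mem_nhds (show (0:ENNReal) < ENNReal.ofReal (1/4) by simp))
    filter_upwards [h2] with n hn
    have hmeas : MeasurableSet {v : ℝ | ε / 2 ≤ |F (r n + m (r n) * v) - F (r n) + q * v|} := by
      apply (isClosed_le _ _).measurableSet <;> fun_prop
    simp only [sub_zero, Real.norm_eq_abs] at hn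
    rwa [Measure.restrict_apply hmeas] at hn
  filter_upwards [key t ht B, key s hs 1, hl] with n h1 h2 h3
  set l := m (s n) / m (t n) with hldef
  have hl0 : 0 < l := by linarith [h3.1]
  have hlm : m (s n) = m (t n) * l := by
    rw [hldef]; field_simp [(hm_pos (t n)).ne']
  obtain ⟨w, hw, hw1, hw2⟩ : ∃ w ∈ Set.Icc (-1:ℝ) 1,
      |F (s n + m (s n) * w) - F (s n) + q * w| < ε / 2 ∧
      |F (t n + m (t n) * (u n + l * w)) - F (t n) + q * (u n + l * w)| < ε / 2 := by
    by_contra hcon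
    push Not at hcon
    set E1 := {v : ℝ | ε / 2 ≤ |F (t n + m (t n) * v) - F (t n) + q * v|} ∩ Set.Icc (-B) B
    set E2 := {v : ℝ | ε / 2 ≤ |F (s n + m (s n) * v) - F (s n) + q * v|} ∩ Set.Icc (-1) 1
    have hsub : Set.Icc (-1:ℝ) 1 ⊆ E2 ∪ (fun w => l * w) ⁻¹' ((fun w => u n + w) ⁻¹' E1) := by
      intro w hw
      by_cases hc : |F (s n + m (s n) * w) - F (s n) + q * w| < ε / 2
      · right
        refine ⟨hcon w hw hc, ?_⟩
        have := abs_le.1 (hu n)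
        have hw' := abs_le.2 hw
        have : |l * w| ≤ 2 := by
          rw [abs_mul, abs_of_pos hl0]; nlinarith [abs_nonneg w, h3.2]
        have := abs_le.1 this
        constructor <;> simp only [hB] <;> linarith
      · left
        exact ⟨not_lt.1 hc, hw⟩
    have hv := measure_mono (μ := volume) hsub
    have hv2 := hv.trans (measure_union_le _ _)
    rw [Real.volume_preimage_mul_left hl0.ne', measure_preimage_add, Real.volume_Icc] at hv2
    have h4 : ENNReal.ofReal |l⁻¹| ≤ ENNReal.ofReal 2 := by
      apply ENNReal.ofReal_le_ofReal
      rw [abs_of_pos (inv_pos.2 hl0)]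
      rw [inv_le_comm₀ hl0 (by norm_num)]; linarith [h3.1]
    have h5 : ENNReal.ofReal (1 - -1) ≤ ENNReal.ofReal (1/4) + ENNReal.ofReal 2 * ENNReal.ofReal (1/4) :=
      hv2.trans (add_le_add h2.le (mul_le_mul' h4 h1.le))
    rw [← ENNReal.ofReal_mul (by norm_num), ← ENNReal.ofReal_add (by norm_num) (by norm_num),
      ENNReal.ofReal_le_ofReal_iff (by norm_num)] at h5
    norm_num at h5
  have heq : t n + m (t n) * (u n + l * w) = s n + m (s n) * w := by
    rw [hlm, hsu n]; ring
  rw [heq] at hw2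
  have hb : |q * (w * (l - 1))| ≤ |q| * |l - 1| := by
    rw [abs_mul, abs_mul]
    have := abs_le.2 hw
    nlinarith [abs_nonneg (l-1), abs_nonneg q, mul_nonneg (abs_nonneg q) (abs_nonneg (l-1))]
  have e1 := abs_lt.1 hw1
  have e2 := abs_lt.1 hw2
  have e3 := abs_le.1 hb
  rw [abs_le]
  constructor <;> nlinarith

lemma shift_atTop (m : ℝ → ℝ) (hm_small : Tendsto (fun t => m t / t) atTop (𝓝 0))
    (t u : ℕ → ℝ) (ht : Tendsto t atTop atTop) (A : ℝ) (hu : ∀ n, |u n| ≤ A) :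
    Tendsto (fun n => (t n + m (t n) * u n) / t n) atTop (𝓝 1) ∧
    Tendsto (fun n => t n + m (t n) * u n) atTop atTop := by
  have h1 : Tendsto (fun n => m (t n) / t n * u n) atTop (𝓝 0) := by
    have := (hm_small.comp ht).zero_mul_isBoundedUnder_le (g := u)
      ⟨A, by simpa using ⟨0, fun b _ => hu b⟩⟩
    exact this
  have h2 : Tendsto (fun n => 1 + m (t n) / t n * u n) atTop (𝓝 1) := by
    simpa using h1.const_add 1
  have h3 : ∀ᶠ n in atTop, 0 < t n := ht.eventually_gt_atTop 0
  have h4 : Tendsto (fun n => (t n + m (t n) * u n) / t n) atTop (𝓝 1) := by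
    refine h2.congr' ?_
    filter_upwards [h3] with n hn
    field_simp
  refine ⟨h4, ?_⟩
  refine (h4.pos_mul_atTop one_pos ht).congr' ?_
  filter_upwards [h3] with n hn
  field_simp

lemma bloom (m : ℝ → ℝ) (hm_cont : Continuous m) (hm_pos : ∀ t, 0 < m t)
    (hm_sn : ∀ x : ℝ, Tendsto (fun t => m (t + m t * x) / m t) atTop (𝓝 1))
    (hm_small : Tendsto (fun t => m t / t) atTop (𝓝 0))
    (t u : ℕ → ℝ) (ht : Tendsto t atTop atTop) (A : ℝ) (hu : ∀ n, |u n| ≤ A) :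
    Tendsto (fun n => m (t n + m (t n) * u n) / m (t n)) atTop (𝓝 1) := by
  have hlogm : Continuous (fun t => Real.log (m t)) := hm_cont.log (fun t => (hm_pos t).ne')
  have hdiv : ∀ a b, Real.log (m a) - Real.log (m b) = Real.log (m a / m b) := fun a b =>
    (Real.log_div (hm_pos a).ne' (hm_pos b).ne').symm
  have hp : ∀ v, Tendsto (fun t => Real.log (m (t + m t * v)) - Real.log (m t) + 0 * v)
      atTop (𝓝 0) := by
    intro v
    have := (hm_sn v).log one_ne_zero
    simpa [hdiv] using this
  have main : ∀ ε > 0, ε ≤ Real.log 2 → ∀ᶠ n in atTop,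
      |Real.log (m (t n + m (t n) * u n)) - Real.log (m (t n))| < ε := by
    intro ε hε hε2
    by_contra hcon
    rw [Filter.not_eventually] at hcon
    obtain ⟨φ, hφ, hbad⟩ := Filter.extraction_of_frequently_atTop hcon
    have hex : ∀ n, ∃ v, |v| ≤ A ∧
        |Real.log (m (t (φ n) + m (t (φ n)) * v)) - Real.log (m (t (φ n)))| = ε := by
      intro n
      have hc : ContinuousOn (fun v => |Real.log (m (t (φ n) + m (t (φ n)) * v)) -
          Real.log (m (t (φ n)))|) (Set.uIcc 0 (u (φ n))) := by
        apply Continuous.continuousOn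
        have : Continuous (fun v => Real.log (m (t (φ n) + m (t (φ n)) * v))) :=
          hlogm.comp (by fun_prop)
        fun_prop
      have h := intermediate_value_uIcc hc
      have hmem : ε ∈ Set.uIcc (|Real.log (m (t (φ n) + m (t (φ n)) * 0)) -
          Real.log (m (t (φ n)))|) (|Real.log (m (t (φ n) + m (t (φ n)) * u (φ n))) -
          Real.log (m (t (φ n)))|) := by
        rw [Set.mem_uIcc]; left
        refine ⟨by simpa using hε.le, not_lt.1 (hbad n)⟩
      obtain ⟨v, hv, hve⟩ := h hmem
      refine ⟨v, ?_, hve⟩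
      have := Set.abs_sub_left_of_mem_uIcc hv
      simp only [sub_zero] at this
      exact this.trans (hu _)
    choose v hvA hve using hex
    have htφ : Tendsto (fun n => t (φ n)) atTop atTop := ht.comp hφ.tendsto_atTop
    have hs := (shift_atTop m hm_small (fun n => t (φ n)) v htφ A hvA).2
    have := uct_core (fun t => Real.log (m t)) m hlogm hm_pos 0 hp (fun n => t (φ n))
      (fun n => t (φ n) + m (t (φ n)) * v n) v htφ hs (fun n => rfl) A hvA
      (by
        refine Filter.Eventually.of_forall (fun n => ?_)
        have h1 := hve n
        rw [hdiv] at h1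
        have h2 := abs_le.1 (h1.le.trans hε2)
        have hpos : 0 < m (t (φ n) + m (t (φ n)) * v n) / m (t (φ n)) :=
          div_pos (hm_pos _) (hm_pos _)
        constructor
        · rw [← Real.log_le_log_iff (by norm_num) hpos]
          rw [one_div, Real.log_inv]; exact h2.1
        · rw [← Real.log_le_log_iff hpos (by norm_num)]
          exact h2.2) (ε / 2) (by positivity)
    obtain ⟨n, hn⟩ := this.exists
    simp only [zero_mul, add_zero, abs_zero, hve n] at hn
    linarith
  have hlog : Tendsto (fun n => Real.log (m (t n + m (t n) * u n)) - Real.log (m (t n)))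
      atTop (𝓝 0) := by
    rw [Metric.tendsto_nhds]
    intro ε hε
    have hl2 : 0 < Real.log 2 := Real.log_pos (by norm_num)
    filter_upwards [main (min ε (Real.log 2)) (lt_min hε hl2) (min_le_right _ _)] with n hn
    rw [Real.dist_eq, sub_zero]
    exact hn.trans_le (min_le_left _ _)
  have := (Real.continuous_exp.tendsto 0).comp hlog
  rw [Real.exp_zero] at this
  refine this.congr (fun n => ?_)
  simp only [Function.comp, hdiv]
  exact Real.exp_log (div_pos (hm_pos _) (hm_pos _))

lemma uct (F m : ℝ → ℝ) (hF : Continuous F) (hm_cont : Continuous m) (hm_pos : ∀ t, 0 < m t)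
    (hm_sn : ∀ x : ℝ, Tendsto (fun t => m (t + m t * x) / m t) atTop (𝓝 1))
    (hm_small : Tendsto (fun t => m t / t) atTop (𝓝 0)) (q : ℝ)
    (hp : ∀ v, Tendsto (fun t => F (t + m t * v) - F t + q * v) atTop (𝓝 0))
    (t u : ℕ → ℝ) (ht : Tendsto t atTop atTop) (A : ℝ) (hu : ∀ n, |u n| ≤ A) :
    Tendsto (fun n => F (t n + m (t n) * u n) - F (t n) + q * u n) atTop (𝓝 0) := by
  have hb := bloom m hm_cont hm_pos hm_sn hm_small t u ht A hu
  have hs := (shift_atTop m hm_small t u ht A hu).2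
  have hq : Tendsto (fun n => |q| * |m (t n + m (t n) * u n) / m (t n) - 1|) atTop (𝓝 0) := by
    have := ((hb.sub_const 1).abs).const_mul |q|
    simpa using this
  rw [Metric.tendsto_nhds]
  intro ε hε
  have hc := uct_core F m hF hm_pos q hp t _ u ht hs (fun n => rfl) A hu
    (by
      filter_upwards [hb.eventually (lt_mem_nhds (show (1/2:ℝ) < 1 by norm_num)),
        hb.eventually (gt_mem_nhds (show (1:ℝ) < 2 by norm_num))] with n h1 h2
      exact ⟨h1.le, h2.le⟩) (ε / 2) (by positivity)
  filter_upwards [hc, hq.eventually (gt_mem_nhds (show (0:ℝ) < ε / 2 by positivity))] with n h1 h2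
  rw [Real.dist_eq, sub_zero]
  linarith

lemma uct_ev (F m : ℝ → ℝ) (hF : Continuous F) (hm_cont : Continuous m) (hm_pos : ∀ t, 0 < m t)
    (hm_sn : ∀ x : ℝ, Tendsto (fun t => m (t + m t * x) / m t) atTop (𝓝 1))
    (hm_small : Tendsto (fun t => m t / t) atTop (𝓝 0)) (q : ℝ)
    (hp : ∀ v, Tendsto (fun t => F (t + m t * v) - F t + q * v) atTop (𝓝 0))
    (A ε : ℝ) (hε : 0 < ε) :
    ∀ᶠ t in atTop, ∀ u, |u| ≤ A → |F (t + m t * u) - F t + q * u| < ε := by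
  by_contra hcon
  rw [Filter.not_eventually] at hcon
  obtain ⟨t, ht, hbad⟩ := Filter.exists_seq_forall_of_frequently hcon
  push Not at hbad
  choose u hu hbad using hbad
  have := uct F m hF hm_cont hm_pos hm_sn hm_small q hp t u ht A hu
  rw [Metric.tendsto_nhds] at this
  obtain ⟨n, hn⟩ := (this ε hε).exists
  rw [Real.dist_eq, sub_zero] at hn
  exact absurd hn (not_lt.2 (hbad n))

lemma potter (h m : ℝ → ℝ) (hh : Continuous h) (hh_pos : ∀ t, 0 < h t)
    (hm_cont : Continuous m) (hm_pos : ∀ t, 0 < m t)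
    (hm_sn : ∀ x : ℝ, Tendsto (fun t => m (t + m t * x) / m t) atTop (𝓝 1))
    (hm_small : Tendsto (fun t => m t / t) atTop (𝓝 0)) (q : ℝ) (hq : 0 < q)
    (hp : ∀ v, Tendsto (fun t => Real.log (h (t + m t * v)) - Real.log (h t) + q * v)
      atTop (𝓝 0)) :
    ∃ C > 0, ∀ᶠ t in atTop, ∀ u, 0 ≤ u → h (t + m t * u) * (1 + u) ^ 2 ≤ C * h t := by
  have hlog : Continuous (fun t => Real.log (h t)) := hh.log (fun t => (hh_pos t).ne')
  have hU := uct_ev _ m hlog hm_cont hm_pos hm_sn hm_small q hp 1 1 one_pos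
  have hU2 := uct_ev _ m hlog hm_cont hm_pos hm_sn hm_small q hp 1 (q / 2) (by positivity)
  set e := Real.exp (q / 4) with he
  have he1 : 1 < e := Real.one_lt_exp_iff.2 (by positivity)
  set B := 1 + 1 / (e - 1) with hB
  have hB1 : 1 ≤ B := by
    have : 0 < 1 / (e - 1) := one_div_pos.2 (by linarith)
    linarith
  have hBe : 1 ≤ B * (e - 1) := by
    have : 1 / (e - 1) * (e - 1) = 1 := by field_simp [(by linarith : e - 1 ≠ 0)]
    nlinarith
  have hM := (hm_sn 1).eventually (gt_mem_nhds he1)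
  obtain ⟨T, hT⟩ := Filter.eventually_atTop.1 (hU.and (hU2.and hM))
  have hquot : ∀ a b c, Real.log (h a) - Real.log (h b) ≤ c → h a ≤ Real.exp c * h b := by
    intro a b c hc
    rw [← Real.log_le_log_iff (hh_pos a) (mul_pos (Real.exp_pos _) (hh_pos b)),
      Real.log_mul (Real.exp_pos _).ne' (hh_pos b).ne', Real.log_exp]
    linarith
  set C := Real.exp 1 * (B + 1) ^ 2 with hC
  have hCpos : 0 < C := by positivity
  refine ⟨C, hCpos, Filter.eventually_atTop.2 ⟨T, ?_⟩⟩
  -- main claim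
  have claim : ∀ x, ∀ t, T ≤ t → t ≤ x → h x * (B + (x - t) / m t) ^ 2 ≤ C * h t := by
    intro x t0 ht0 ht0x
    have hTx : T ≤ x := ht0.trans ht0x
    obtain ⟨c, hc, hcmin⟩ := (isCompact_Icc (a := T) (b := x)).exists_isMinOn
      ⟨T, le_refl _, hTx⟩ hm_cont.continuousOn
    have hμ := hm_pos c
    have ind : ∀ n : ℕ, ∀ t, T ≤ t → t ≤ x → x - t ≤ n * m c →
        h x * (B + (x - t) / m t) ^ 2 ≤ C * h t := by
      have base : ∀ t, T ≤ t → t ≤ x → x - t ≤ m t →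
          h x * (B + (x - t) / m t) ^ 2 ≤ C * h t := by
        intro t ht htx hle
        have hmt := hm_pos t
        have h0 : 0 ≤ (x - t) / m t := div_nonneg (by linarith) hmt.le
        have h1 : (x - t) / m t ≤ 1 := (div_le_one hmt).2 hle
        have h2 := (hT t ht).1 ((x - t) / m t) (by rw [abs_of_nonneg h0]; exact h1)
        have h3 : t + m t * ((x - t) / m t) = x := by field_simp; ring
        rw [h3] at h2
        have h4 : h x ≤ Real.exp 1 * h t := by
          apply hquot
          have := (abs_lt.1 h2).2
          nlinarith
        have h5 : (B + (x - t) / m t) ^ 2 ≤ (B + 1) ^ 2 := by gcongr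
        calc _ ≤ (Real.exp 1 * h t) * (B + 1) ^ 2 :=
              mul_le_mul h4 h5 (by positivity) (mul_pos (Real.exp_pos _) (hh_pos t)).le
          _ = _ := by rw [hC]; ring
      intro n
      induction n with
      | zero =>
        intro t ht htx hle
        exact base t ht htx (by simp at hle; linarith [hm_pos t])
      | succ n ih =>
        intro t ht htx hle
        by_cases hcase : x - t ≤ m t
        · exact base t ht htx hcase
        push Not at hcase
        have hmt := hm_pos t
        have hmc : m c ≤ m t := hcmin ⟨ht, htx⟩
        push_cast at hle
        have hi := ih (t + m t) (by linarith) (by linarith) (by linarith)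
        have hmt' := hm_pos (t + m t)
        have hr := (hT t ht).2.2
        rw [mul_one, div_lt_iff₀ hmt] at hr
        have h2 := (hT t ht).2.1 1 (by simp)
        rw [mul_one, mul_one] at h2
        have h4 : h (t + m t) ≤ Real.exp (-(q / 2)) * h t := by
          apply hquot
          have := (abs_lt.1 h2).2
          linarith
        set u' := (x - (t + m t)) / m (t + m t) with hu'
        have hu'0 : 0 ≤ u' := div_nonneg (by linarith) hmt'.le
        have h6 : (x - t) / m t ≤ 1 + e * u' := by
          rw [div_le_iff₀ hmt]
          have : x - (t + m t) = u' * m (t + m t) := by rw [hu']; field_simp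
          nlinarith
        have h0 : 0 ≤ (x - t) / m t := div_nonneg (by linarith) hmt.le
        have h7 : B + (x - t) / m t ≤ e * (B + u') := by nlinarith
        have h8 : (B + (x - t) / m t) ^ 2 ≤ (e * (B + u')) ^ 2 := by gcongr
        have h9 : e ^ 2 * Real.exp (-(q / 2)) = 1 := by
          rw [he, ← Real.exp_nat_mul, ← Real.exp_add]
          norm_num; ring
        calc h x * (B + (x - t) / m t) ^ 2 ≤ h x * (e * (B + u')) ^ 2 :=
              mul_le_mul_of_nonneg_left h8 (hh_pos x).le
          _ = e ^ 2 * (h x * (B + u') ^ 2) := by ring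
          _ ≤ e ^ 2 * (C * h (t + m t)) := by gcongr
          _ ≤ e ^ 2 * (C * (Real.exp (-(q / 2)) * h t)) := by gcongr
          _ = (e ^ 2 * Real.exp (-(q / 2))) * (C * h t) := by ring
          _ = C * h t := by rw [h9, one_mul]
    obtain ⟨n, hn⟩ := exists_nat_ge ((x - t0) / m c)
    exact ind n t0 ht0 ht0x ((div_le_iff₀ hμ).1 hn)
  intro t ht u hu
  have hmt := hm_pos t
  have := claim (t + m t * u) t ht (by nlinarith)
  have h3 : (t + m t * u - t) / m t = u := by field_simp; ring
  rw [h3] at this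
  refine le_trans ?_ this
  have := hh_pos (t + m t * u)
  gcongr

lemma Ilim (g m : ℝ → ℝ) (hg : Continuous g) (hg_pos : ∀ t, 0 < g t)
    (hm_cont : Continuous m) (hm_pos : ∀ t, 0 < m t)
    (hm_sn : ∀ x : ℝ, Tendsto (fun t => m (t + m t * x) / m t) atTop (𝓝 1))
    (hm_small : Tendsto (fun t => m t / t) atTop (𝓝 0)) (q : ℝ) (hq : 0 < q)
    (hp : ∀ v, Tendsto (fun t => Real.log (g (q * (t + m t * v) ^ 2)) -
      Real.log (g (q * t ^ 2)) + q * v) atTop (𝓝 0)) :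
    Tendsto (fun t => ∫ r in Set.Ioi (0:ℝ), g (r ^ 2 * (q * m t * t) + q * t ^ 2) / g (q * t ^ 2))
      atTop (𝓝 (∫ r in Set.Ioi (0:ℝ), Real.exp (-(q * (r ^ 2 / 2))))) := by
  set h : ℝ → ℝ := fun t => g (q * t ^ 2) with hh
  have hhc : Continuous h := by fun_prop
  have hhp : ∀ t, 0 < h t := fun t => hg_pos _
  obtain ⟨C, hC, hpot⟩ := potter h m hhc hhp hm_cont hm_pos hm_sn hm_small q hq hp
  set U : ℝ → ℝ → ℝ := fun t r => r ^ 2 / (1 + √(1 + m t / t * r ^ 2)) with hU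
  have hrep : ∀ t, 0 < t → ∀ r, g (r ^ 2 * (q * m t * t) + q * t ^ 2) = h (t + m t * U t r) := by
    intro t ht r
    simp only [hh, hU]
    congr 1
    have hmt := hm_pos t
    have hR : √(1 + m t / t * r ^ 2) ^ 2 = 1 + m t / t * r ^ 2 := Real.sq_sqrt (by positivity)
    have hR0 : 0 ≤ √(1 + m t / t * r ^ 2) := Real.sqrt_nonneg _
    set R := √(1 + m t / t * r ^ 2)
    have h1 : t + m t * (r ^ 2 / (1 + R)) = t * R := by
      have h2 : m t * r ^ 2 = t * (R ^ 2 - 1) := by rw [hR]; field_simp; ring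
      have : (1 + R) ≠ 0 := by positivity
      rw [← mul_div_assoc, h2]; field_simp; ring
    rw [h1, mul_pow, hR]; field_simp; ring
  have hlogc : Continuous (fun t => Real.log (h t)) := hhc.log (fun t => (hhp t).ne')
  refine tendsto_integral_filter_of_dominated_convergence (fun r => 9 * C * (1 + r ^ 2)⁻¹) ?_ ?_ ?_ ?_
  · refine Filter.Eventually.of_forall (fun t => ?_)
    apply Continuous.aestronglyMeasurable
    fun_prop
  · have hsm := hm_small.eventually (gt_mem_nhds one_pos)
    filter_upwards [hpot, hsm, eventually_gt_atTop 0] with t h1 h2 h3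
    refine (ae_restrict_iff' measurableSet_Ioi).2 (Filter.Eventually.of_forall fun r hr => ?_)
    have hr0 : 0 < r := hr
    have hmt := hm_pos t
    have hd : 0 < m t / t := div_pos hmt h3
    rw [hrep t h3 r]
    have hR1 : √(1 + m t / t * r ^ 2) ≤ 1 + r := by
      rw [Real.sqrt_le_left (by positivity)]
      nlinarith [sq_nonneg r]
    have hR0 : 0 ≤ √(1 + m t / t * r ^ 2) := Real.sqrt_nonneg _
    have hU0 : 0 ≤ U t r := by simp only [hU]; positivity
    have hU1 : (1 + r) / 3 ≤ 1 + U t r := by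
      have : r ^ 2 / (2 + r) ≤ U t r := by
        simp only [hU]
        apply div_le_div_of_nonneg_left (by positivity) (by positivity)
        linarith
      have h5 : (1 + r) / 3 ≤ 1 + r ^ 2 / (2 + r) := by
        have : 1 + r ^ 2 / (2 + r) = (2 + r + r ^ 2) / (2 + r) := by field_simp
        rw [this, div_le_div_iff₀ (by norm_num) (by positivity)]
        nlinarith [sq_nonneg r]
      linarith
    have hb := h1 (U t r) hU0
    have hU2 : (1 + r ^ 2) / 9 ≤ (1 + U t r) ^ 2 := by nlinarith
    have hpx := hhp (t + m t * U t r)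
    rw [Real.norm_of_nonneg (div_pos hpx (hg_pos _)).le, ← div_eq_mul_inv,
      div_le_div_iff₀ (hg_pos _) (by positivity)]
    have : h (t + m t * U t r) * ((1 + r ^ 2) / 9) ≤ C * h t :=
      (mul_le_mul_of_nonneg_left hU2 hpx.le).trans hb
    simp only [hh] at this ⊢
    linarith
  · exact (integrable_inv_one_add_sq.const_mul _).integrableOn
  · refine Filter.Eventually.of_forall fun r => ?_
    have hUl : Tendsto (fun t => U t r) atTop (𝓝 (r ^ 2 / 2)) := by
      have h1 : Tendsto (fun t => 1 + √(1 + m t / t * r ^ 2)) atTop (𝓝 (1 + √(1 + 0 * r ^ 2))) :=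
        (((hm_small.mul_const _).const_add 1).sqrt).const_add 1
      have h2 := (tendsto_const_nhds (x := r ^ 2)).div h1 (by positivity)
      norm_num at h2
      exact h2
    have hUb : ∀ᶠ t in atTop, |U t r| ≤ r ^ 2 / 2 + 1 := by
      filter_upwards [hUl.eventually (gt_mem_nhds (show r^2/2 < r^2/2+1 by linarith))] with t ht
      have : 0 ≤ U t r := by simp only [hU]; positivity
      rw [abs_of_nonneg this]; exact ht.le
    have hlim : Tendsto (fun t => Real.log (h (t + m t * U t r)) - Real.log (h t) + q * U t r)
        atTop (𝓝 0) := by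
      rw [Metric.tendsto_nhds]
      intro ε hε
      filter_upwards [hUb, uct_ev _ m hlogc hm_cont hm_pos hm_sn hm_small q hp (r^2/2+1) ε hε]
        with t h1 h2
      rw [Real.dist_eq, sub_zero]
      exact h2 _ h1
    have hlim2 := hlim.sub (hUl.const_mul q)
    have h3 := (Real.continuous_exp.tendsto _).comp hlim2
    rw [zero_sub] at h3
    refine h3.congr' ?_
    filter_upwards [eventually_gt_atTop 0] with t ht
    rw [hrep t ht r]
    simp only [Function.comp, add_sub_cancel_right]
    rw [Real.exp_sub, Real.exp_log (hhp _), Real.exp_log (hhp _)]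

lemma gd_ratio (g m gd : ℝ → ℝ) (hg : Continuous g) (hg_pos : ∀ t, 0 < g t)
    (hm_cont : Continuous m) (hm_pos : ∀ t, 0 < m t)
    (hm_sn : ∀ x : ℝ, Tendsto (fun t => m (t + m t * x) / m t) atTop (𝓝 1))
    (hm_small : Tendsto (fun t => m t / t) atTop (𝓝 0)) (q : ℝ) (hq : 0 < q)
    (hp : ∀ v, Tendsto (fun t => Real.log (g (q * (t + m t * v) ^ 2)) -
      Real.log (g (q * t ^ 2)) + q * v) atTop (𝓝 0))
    (hgd : ∀ s, gd s = 2 * ∫ r in Set.Ioi (0:ℝ), g (r ^ 2 + s))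
    (t u : ℕ → ℝ) (ht : Tendsto t atTop atTop) (A : ℝ) (hu : ∀ n, |u n| ≤ A) :
    Tendsto (fun n => gd (q * (t n + m (t n) * u n) ^ 2) / gd (q * t n ^ 2) * Real.exp (q * u n))
      atTop (𝓝 1) := by
  set L : ℝ → ℝ := fun t =>
    ∫ r in Set.Ioi (0:ℝ), g (r ^ 2 * (q * m t * t) + q * t ^ 2) / g (q * t ^ 2) with hL
  set c := ∫ r in Set.Ioi (0:ℝ), Real.exp (-(q * (r ^ 2 / 2))) with hc
  have hLc : Tendsto L atTop (𝓝 c) :=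
    Ilim g m hg hg_pos hm_cont hm_pos hm_sn hm_small q hq hp
  have hcpos : 0 < c := by
    have : c = ∫ r in Set.Ioi (0:ℝ), Real.exp (-(q / 2) * r ^ 2) := by
      rw [hc]; congr 1; ext r; congr 1; ring
    rw [this, integral_gaussian_Ioi]; positivity
  have hform : ∀ t, 0 < t → gd (q * t ^ 2) = 2 * √(q * m t * t) * g (q * t ^ 2) * L t := by
    intro t ht
    have hmt := hm_pos t
    have hk : 0 < √(q * m t * t) := Real.sqrt_pos.2 (by positivity)
    have hsub := integral_comp_mul_left_Ioi (fun r => g (r ^ 2 + q * t ^ 2)) 0 hk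
    rw [mul_zero, smul_eq_mul] at hsub
    have h1 : L t = (∫ r in Set.Ioi (0:ℝ), g ((√(q * m t * t) * r) ^ 2 + q * t ^ 2)) /
        g (q * t ^ 2) := by
      simp only [hL]
      rw [integral_div]
      congr 2
      ext r
      rw [mul_pow, Real.sq_sqrt (by positivity), mul_comm]
    have := hg_pos (q * t ^ 2)
    rw [h1, hgd, hsub]
    field_simp
  obtain ⟨hst, hs⟩ := shift_atTop m hm_small t u ht A hu
  have hb := bloom m hm_cont hm_pos hm_sn hm_small t u ht A hu
  have hlogc : Continuous (fun t => Real.log (g (q * t ^ 2))) :=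
    Continuous.log (by fun_prop) (fun t => (hg_pos _).ne')
  have hF := uct _ m hlogc hm_cont hm_pos hm_sn hm_small q hp t u ht A hu
  have hF2 := (Real.continuous_exp.tendsto 0).comp hF
  have hsq := (hb.mul hst).sqrt
  have hLL := (hLc.comp hs).div (hLc.comp ht) hcpos.ne'
  have hall := (hsq.mul hF2).mul hLL
  rw [div_self hcpos.ne', Real.exp_zero, mul_one, mul_one, mul_one, Real.sqrt_one] at hall
  refine hall.congr' ?_
  filter_upwards [ht.eventually_gt_atTop 0, hs.eventually_gt_atTop 0,
    (hLc.comp ht).eventually (lt_mem_nhds hcpos)] with n h1 h2 h3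
  simp only [Function.comp, Pi.div_apply] at h3 ⊢
  rw [hform _ h1, hform _ h2, Real.exp_add, Real.exp_sub, Real.exp_log (hg_pos _),
    Real.exp_log (hg_pos _)]
  set s := t n + m (t n) * u n
  have hms := hm_pos s
  have hmt := hm_pos (t n)
  have e1 : √(m s / m (t n) * (s / t n)) = √(q * m s * s) / √(q * m (t n) * t n) := by
    rw [← Real.sqrt_div (by positivity)]
    congr 1
    field_simp
  rw [e1]
  have k1 : 0 < √(q * m (t n) * t n) := Real.sqrt_pos.2 (by positivity)
  have k2 := hg_pos (q * t n ^ 2)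
  field_simp

lemma quad_ratio (g m gd : ℝ → ℝ) (hg : Continuous g) (hg_pos : ∀ t, 0 < g t)
    (hm_cont : Continuous m) (hm_pos : ∀ t, 0 < m t)
    (hm_sn : ∀ x : ℝ, Tendsto (fun t => m (t + m t * x) / m t) atTop (𝓝 1))
    (hm_small : Tendsto (fun t => m t / t) atTop (𝓝 0)) (q : ℝ) (hq : 0 < q)
    (hp : ∀ v, Tendsto (fun t => Real.log (g (q * (t + m t * v) ^ 2)) -
      Real.log (g (q * t ^ 2)) + q * v) atTop (𝓝 0))
    (hgd : ∀ s, gd s = 2 * ∫ r in Set.Ioi (0:ℝ), g (r ^ 2 + s))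
    (t y z : ℕ → ℝ) (ht : Tendsto t atTop atTop) (Y Z : ℝ) (hy : ∀ n, |y n| ≤ Y)
    (hz : ∀ n, |z n| ≤ Z)
    (hX : ∀ n, 0 ≤ q * t n ^ 2 + 2 * t n * m (t n) * y n + m (t n) ^ 2 * z n) :
    Tendsto (fun n => gd (q * t n ^ 2 + 2 * t n * m (t n) * y n + m (t n) ^ 2 * z n) /
      gd (q * t n ^ 2) - Real.exp (-(y n))) atTop (𝓝 0) := by
  have hY : 0 ≤ Y := (abs_nonneg _).trans (hy 0)
  have hZ : 0 ≤ Z := (abs_nonneg _).trans (hz 0)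
  set s : ℕ → ℝ := fun n => √((q * t n ^ 2 + 2 * t n * m (t n) * y n + m (t n) ^ 2 * z n) / q)
    with hs
  have hs0 : ∀ n, 0 ≤ s n := fun n => Real.sqrt_nonneg _
  have hs2 : ∀ n, q * s n ^ 2 = q * t n ^ 2 + 2 * t n * m (t n) * y n + m (t n) ^ 2 * z n := by
    intro n
    simp only [hs]
    rw [Real.sq_sqrt (div_nonneg (hX n) hq.le)]; field_simp
  set A := (2 * Y + Z) / q with hA
  have hA0 : 0 ≤ A := by positivity
  set v : ℕ → ℝ := fun n => (s n - t n) / m (t n) with hv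
  have hsv : ∀ n, t n + m (t n) * v n = s n := by
    intro n
    have := hm_pos (t n)
    simp only [hv]; field_simp; ring
  have hev : ∀ᶠ n in atTop, 0 < t n ∧ m (t n) ≤ t n := by
    filter_upwards [ht.eventually_gt_atTop 0,
      (hm_small.comp ht).eventually (gt_mem_nhds one_pos)] with n h1 h2
    simp only [Function.comp] at h2
    rw [div_lt_one h1] at h2
    exact ⟨h1, h2.le⟩
  have hvid : ∀ n, q * (v n * (s n + t n)) = 2 * t n * y n + m (t n) * z n := by
    intro n
    have := hm_pos (t n)
    have h1 := hs2 n
    have h2 := hsv n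
    have : m (t n) * (q * (v n * (s n + t n))) = m (t n) * (2 * t n * y n + m (t n) * z n) := by
      have : m (t n) * v n = s n - t n := by linarith
      calc _ = q * (m (t n) * v n) * (s n + t n) := by ring
        _ = q * s n ^ 2 - q * t n ^ 2 := by rw [this]; ring
        _ = _ := by rw [h1]; ring
    exact mul_left_cancel₀ (hm_pos (t n)).ne' this
  have hvA : ∀ᶠ n in atTop, |v n| ≤ A := by
    filter_upwards [hev] with n hn
    have hst : 0 < s n + t n := by linarith [hs0 n]
    have hmt := hm_pos (t n)
    have h1 : q * (|v n| * (s n + t n)) ≤ 2 * t n * Y + t n * Z := by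
      have : q * (|v n| * (s n + t n)) = |2 * t n * y n + m (t n) * z n| := by
        rw [← hvid n, abs_mul, abs_mul, abs_of_pos hq, abs_of_pos hst]
      rw [this]
      refine (abs_add_le _ _).trans ?_
      rw [abs_mul (2 * t n), abs_mul (m (t n)), abs_of_pos (by linarith [hn.1] : 0 < 2 * t n), abs_of_pos hmt]
      have a1 := hy n
      have a2 := hz n
      have := hn.1
      have := hn.2
      gcongr
    rw [hA, le_div_iff₀ hq]
    have h2 : q * (|v n| * t n) ≤ q * (|v n| * (s n + t n)) := by
      gcongr; linarith [hs0 n]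
    have h3 : (|v n| * q) * t n ≤ (2 * Y + Z) * t n := by linarith
    exact le_of_mul_le_mul_right h3 hn.1
  have hdiff : Tendsto (fun n => q * v n - y n) atTop (𝓝 0) := by
    have hbd : Tendsto (fun n => m (t n) / t n * (Y * A + Z)) atTop (𝓝 0) := by
      simpa using (hm_small.comp ht).mul_const (Y * A + Z)
    refine squeeze_zero_norm' ?_ hbd
    filter_upwards [hev, hvA] with n hn hvn
    have hst : 0 < s n + t n := by linarith [hs0 n]
    have hmt := hm_pos (t n)
    have h1 : (q * v n - y n) * (s n + t n) = m (t n) * (z n - y n * v n) := by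
      have h2 := hvid n
      have h3 := hsv n
      have : s n - t n = m (t n) * v n := by linarith
      calc _ = q * (v n * (s n + t n)) - y n * (s n + t n) := by ring
        _ = m (t n) * z n - y n * (s n - t n) := by rw [h2]; ring
        _ = _ := by rw [this]; ring
    have h4 : |q * v n - y n| * (s n + t n) ≤ m (t n) * (Y * A + Z) := by
      have : |q * v n - y n| * (s n + t n) = m (t n) * |z n - y n * v n| := by
        rw [← abs_of_pos hmt, ← abs_mul, ← h1, abs_mul, abs_of_pos hst]
      rw [this]
      have : |z n - y n * v n| ≤ Y * A + Z := by
        refine (abs_sub _ _).trans ?_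
        rw [abs_mul]
        have := mul_le_mul (hy n) hvn (abs_nonneg _) hY
        linarith [hz n]
      gcongr
    rw [Real.norm_eq_abs, div_mul_eq_mul_div, le_div_iff₀ hn.1]
    refine le_trans ?_ h4
    have := hs0 n
    gcongr
    linarith
  -- truncated sequence
  set u : ℕ → ℝ := fun n => max (-A) (min A (v n)) with hu
  have huA : ∀ n, |u n| ≤ A := by
    intro n
    rw [abs_le]
    exact ⟨le_max_left _ _, max_le (by linarith) (min_le_left _ _)⟩
  have huv : ∀ᶠ n in atTop, u n = v n := by
    filter_upwards [hvA] with n hn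
    have := abs_le.1 hn
    simp only [hu]
    rw [min_eq_right this.2, max_eq_right this.1]
  have hr := gd_ratio g m gd hg hg_pos hm_cont hm_pos hm_sn hm_small q hq hp hgd t u ht A huA
  have he := (Real.continuous_exp.tendsto _).comp hdiff.neg
  have hprod := (hr.mul he).sub_const 1
  rw [neg_zero, Real.exp_zero, mul_one, sub_self] at hprod
  have hfin : Tendsto (fun n => (gd (q * t n ^ 2 + 2 * t n * m (t n) * y n + m (t n) ^ 2 * z n) /
      gd (q * t n ^ 2) * Real.exp (y n) - 1)) atTop (𝓝 0) := by
    refine hprod.congr' ?_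
    filter_upwards [huv] with n hn
    simp only [Function.comp]
    rw [hn, hsv, hs2, mul_assoc _ (Real.exp _), ← Real.exp_add]
    congr 3
    ring_nf
  have hbdd := hfin.zero_mul_isBoundedUnder_le (g := fun n => Real.exp (-(y n)))
      ⟨Real.exp Y, by
        simp only [eventually_map, Function.comp, Real.norm_eq_abs, Real.abs_exp]
        exact Filter.Eventually.of_forall fun n => Real.exp_le_exp.2 (by linarith [(abs_le.1 (hy n)).1])⟩
  refine hbdd.congr (fun n => ?_)
  rw [sub_mul, one_mul, mul_assoc, ← Real.exp_add, add_neg_cancel, Real.exp_zero, mul_one]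

/-- If the `(d+1)`-dimensional density generator `g` is in the quadratic max-domain of
attraction of the Gumbel distribution with auxiliary function `m`, then the marginal
generator `g_d(s) = 2∫_0^∞ g(r² + s) dr` satisfies, for every positive-definite `Σ`,
`g_d({t1+m(t)w}Σ⁻¹{t1+m(t)w}ᵀ)/g_d(t² 1Σ⁻¹1ᵀ) → exp(-wΣ⁻¹1ᵀ)` locally uniformly in `w`. -/
theorem rapid_variation_stmt14 (d : ℕ) (g m : ℝ → ℝ)
    (hg_cont : Continuous g) (hg_pos : ∀ t, 0 < g t)
    (hm_cont : Continuous m) (hm_pos : ∀ t, 0 < m t)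
    (hm_sn : ∀ x : ℝ, Tendsto (fun t => m (t + m t * x) / m t) atTop (𝓝 1))
    (hm_small : Tendsto (fun t => m t / t) atTop (𝓝 0))
    (hMDA : ∀ Q : Matrix (Fin (d+1)) (Fin (d+1)) ℝ, Q.PosSemidef →
      ∀ x : Fin (d+1) → ℝ,
      Tendsto (fun t =>
          g ((fun i => t + m t * x i) ⬝ᵥ Q.mulVec (fun i => t + m t * x i)) /
            g (t ^ 2 * ((fun _ => (1:ℝ)) ⬝ᵥ Q.mulVec (fun _ => (1:ℝ)))))
        atTop (𝓝 (Real.exp (-(x ⬝ᵥ Q.mulVec (fun _ => (1:ℝ)))))))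
    (hfin : ∀ s : ℝ, 0 ≤ s → IntegrableOn (fun r => g (r ^ 2 + s)) (Set.Ioi 0))
    (gd : ℝ → ℝ)
    (hgd : ∀ s, gd s = 2 * ∫ r in Set.Ioi (0:ℝ), g (r ^ 2 + s)) :
    ∀ S : Matrix (Fin d) (Fin d) ℝ, S.PosDef →
      ∀ K : Set (Fin d → ℝ), IsCompact K →
        TendstoUniformlyOn (fun t w =>
            gd ((fun i => t + m t * w i) ⬝ᵥ S⁻¹.mulVec (fun i => t + m t * w i)) /
              gd (t ^ 2 * ((fun _ => (1:ℝ)) ⬝ᵥ S⁻¹.mulVec (fun _ => (1:ℝ)))))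
          (fun w => Real.exp (-(w ⬝ᵥ S⁻¹.mulVec (fun _ => (1:ℝ))))) atTop K := by
  intro S hS K hK
  have hP : S⁻¹.PosDef := hS.inv
  set P := S⁻¹ with hPdef
  set one : Fin d → ℝ := fun _ => 1 with hone
  set q := one ⬝ᵥ P.mulVec one with hqdef
  have hsymm : ∀ w, one ⬝ᵥ P.mulVec w = w ⬝ᵥ P.mulVec one := by
    intro w
    have hT : Pᵀ = P := by simpa [Matrix.IsHermitian] using hP.isHermitian
    rw [Matrix.dotProduct_mulVec, ← Matrix.mulVec_transpose, hT, dotProduct_comm]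
  have hexp : ∀ (t a : ℝ) (w : Fin d → ℝ),
      (fun i => t + a * w i) ⬝ᵥ P.mulVec (fun i => t + a * w i) =
        q * t ^ 2 + 2 * t * a * (w ⬝ᵥ P.mulVec one) + a ^ 2 * (w ⬝ᵥ P.mulVec w) := by
    intro t a w
    have : (fun i => t + a * w i) = t • one + a • w := by
      ext i; simp [hone]
    rw [this]
    simp only [Matrix.mulVec_add, Matrix.mulVec_smul, dotProduct_add, add_dotProduct,
      smul_dotProduct, dotProduct_smul, smul_eq_mul, hsymm w]
    rw [← hqdef]; ring
  have hnn : ∀ w : Fin d → ℝ, 0 ≤ w ⬝ᵥ P.mulVec w := fun w => by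
    simpa using hP.posSemidef.dotProduct_mulVec_nonneg w
  rcases Nat.eq_zero_or_pos d with hd | hd
  · subst hd
    have h0 : gd 0 ≠ 0 := by
      rw [hgd]
      have : 0 < ∫ r in Set.Ioi (0:ℝ), g (r ^ 2 + 0) := by
        rw [integral_pos_iff_support_of_nonneg (fun r => (hg_pos _).le) (hfin 0 le_rfl)]
        have : Function.support (fun r => g (r ^ 2 + 0)) = Set.univ := by
          ext r; simp [(hg_pos _).ne']
        rw [this]; simp
      positivity
    rw [Metric.tendstoUniformlyOn_iff]
    intro ε hε
    refine Filter.Eventually.of_forall fun t w _ => ?_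
    simp [dotProduct, hqdef, div_self h0, hε]
  have hq : 0 < q := by
    have hne : one ≠ 0 := fun h => by
      have := congrFun h ⟨0, hd⟩
      simp [hone] at this
    simpa using hP.dotProduct_mulVec_pos hne
  have hp : ∀ v, Tendsto (fun t => Real.log (g (q * (t + m t * v) ^ 2)) -
      Real.log (g (q * t ^ 2)) + q * v) atTop (𝓝 0) := by
    intro v
    have h1 := hMDA (Matrix.diagonal (fun i => if i = 0 then q else 0))
      (Matrix.PosSemidef.diagonal (fun i => by dsimp only; split_ifs <;> simp [hq.le]))
      (fun _ => v)
    have h2 := (h1.log (Real.exp_pos _).ne').add_const (q * v)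
    simp only [Matrix.mulVec_diagonal, dotProduct, Real.log_exp, ite_mul, zero_mul, mul_ite, mul_zero,
      Finset.sum_ite_eq', Finset.mem_univ, if_true, mul_one, one_mul] at h2
    rw [show -(v * q) + q * v = 0 by ring] at h2
    refine h2.congr fun t => ?_
    rw [Real.log_div (hg_pos _).ne' (hg_pos _).ne']
    ring_nf
  have hy_cont : Continuous (fun w : Fin d → ℝ => w ⬝ᵥ P.mulVec one) := by fun_prop
  have hz_cont : Continuous (fun w : Fin d → ℝ => w ⬝ᵥ P.mulVec w) := by fun_prop
  obtain ⟨Y, hY⟩ := hK.exists_bound_of_continuousOn hy_cont.continuousOn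
  obtain ⟨Z, hZ⟩ := hK.exists_bound_of_continuousOn hz_cont.continuousOn
  rw [Metric.tendstoUniformlyOn_iff]
  intro ε hε
  by_contra hcon
  rw [Filter.not_eventually] at hcon
  obtain ⟨t, ht, hbad⟩ := Filter.exists_seq_forall_of_frequently hcon
  push Not at hbad
  choose w hw hbad using hbad
  have := quad_ratio g m gd hg_cont hg_pos hm_cont hm_pos hm_sn hm_small q hq hp hgd t
    (fun n => w n ⬝ᵥ P.mulVec one) (fun n => w n ⬝ᵥ P.mulVec (w n)) ht Y Z
    (fun n => hY _ (hw n)) (fun n => hZ _ (hw n))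
    (fun n => by rw [← hexp]; exact hnn _)
  rw [Metric.tendsto_nhds] at this
  obtain ⟨n, hn⟩ := (this ε hε).exists
  have hb := hbad n
  rw [hexp, dist_comm, Real.dist_eq, mul_comm (t n ^ 2)] at hb
  rw [Real.dist_eq, sub_zero] at hn
  exact absurd hn (not_lt.2 hb)
end
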